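/- Let n ≥ 2 and 2 ≤ k ≤ 2n−1, and let g ∈ SL_{2n}(ℝ). Then the closure in ℝ^{k(k−1)/2} of the set {(⟨v_i, v_j⟩^g)_{1≤i<j≤k} : v_1, …, v_k ∈ ℤ^{2n}} contains the set {(⟨v_i, v_j⟩^g)_{1≤i<j≤k} : v_1, …, v_k ∈ ℝ^{2n}} (i.e., the integer image set is dense in the real image set) if and only if ⟨·,·⟩^g is irrational. -/

import Mathlib

open Matrix MeasureTheory

noncomputable section

abbrev Pairs (k : ℕ) := {p : Fin k × Fin k // p.1 < p.2}

/-- The standard symplectic matrix `J_n` with block form `(0 Iₙ; -Iₙ 0)`. -/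
def Jmat (n : ℕ) : Matrix (Fin (2*n)) (Fin (2*n)) ℝ :=
  fun i j => if (i : ℕ) + n = (j : ℕ) then 1 else if (j : ℕ) + n = (i : ℕ) then -1 else 0

/-- The standard symplectic form `⟨v,w⟩ = vᵀ Jₙ w` on `ℝ^{2n}`. -/
def symp (n : ℕ) (v w : Fin (2*n) → ℝ) : ℝ := v ⬝ᵥ (Jmat n).mulVec w

abbrev SL2n (n : ℕ) := Matrix.SpecialLinearGroup (Fin (2*n)) ℝ

/-- The symplectic form `⟨v,w⟩^g = ⟨g v, g w⟩` attached to `g ∈ SL_{2n}(ℝ)`. -/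
def sympG (n : ℕ) (g : SL2n n) (v w : Fin (2*n) → ℝ) : ℝ :=
  symp n ((g : Matrix (Fin (2*n)) (Fin (2*n)) ℝ).mulVec v)
         ((g : Matrix (Fin (2*n)) (Fin (2*n)) ℝ).mulVec w)

/-- Euclidean norm on `ℝ^d` (presented as `Fin d → ℝ`). -/
def enorm2 {d : ℕ} (v : Fin d → ℝ) : ℝ := Real.sqrt (∑ i, (v i)^2)

/-- The form `⟨·,·⟩^g` is rational: some nonzero scalar multiple of `gᵀ Jₙ g` has
integer entries. -/
def IsRationalForm (n : ℕ) (g : SL2n n) : Prop :=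
  ∃ c : ℝ, c ≠ 0 ∧ ∀ i j, ∃ m : ℤ,
    c * (((g : Matrix (Fin (2*n)) (Fin (2*n)) ℝ)ᵀ * Jmat n *
          (g : Matrix (Fin (2*n)) (Fin (2*n)) ℝ)) i j) = (m : ℝ)

open Filter Topology

def Kd (M : ℕ) (N : ℕ) : ℝ := ∑ j ∈ Finset.range N, (M:ℝ)^j

lemma Kd_nonneg (M N : ℕ) : 0 ≤ Kd M N := Finset.sum_nonneg (fun _ _ => by positivity)

lemma Kd_le (M : ℕ) (hM : 2 ≤ M) (N : ℕ) : M * Kd M N ≤ 2 * (M:ℝ)^N := by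
  have hM' : (2:ℝ) ≤ M := by exact_mod_cast hM
  induction N with
  | zero => simp [Kd]
  | succ N ih =>
    unfold Kd at *
    rw [Finset.sum_range_succ, mul_add, pow_succ]
    have : 0 ≤ (M:ℝ)^N := by positivity
    nlinarith

lemma digit (M : ℕ) (hM : 2 ≤ M) : ∀ (N : ℕ) (y : Fin N → ℝ) (s0 : ℝ),
    ∃ (s : ℝ) (w : Fin N → ℤ), s0 ≤ s ∧ s ≤ s0 + Kd M N ∧
      ∀ j : Fin N, |(w j : ℝ) - y j - s * ((1:ℝ)/M)^(j:ℕ)| ≤ 2 / M := by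
  have hM' : (2:ℝ) ≤ M := by exact_mod_cast hM
  have hM0 : (0:ℝ) < M := by linarith
  intro N
  induction N with
  | zero => intro y s0; exact ⟨s0, fun _ => 0, le_rfl, by simp [Kd], fun j => j.elim0⟩
  | succ N ih =>
    intro y s0
    have hP : (0:ℝ) < (M:ℝ)^N := by positivity
    set n := ⌈s0 / (M:ℝ)^N + y (Fin.last N)⌉ with hn
    have h1 : s0 / (M:ℝ)^N + y (Fin.last N) ≤ n := Int.le_ceil _
    have h2 : (n:ℝ) < s0 / (M:ℝ)^N + y (Fin.last N) + 1 := Int.ceil_lt_add_one _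
    obtain ⟨s, w, hs0, hs1, hw⟩ := ih (fun j => y j.castSucc) ((n - y (Fin.last N)) * (M:ℝ)^N)
    have e : s0 / (M:ℝ)^N * (M:ℝ)^N = s0 := by field_simp
    refine ⟨s, Fin.snoc w n, ?_, ?_, ?_⟩
    · nlinarith
    · have : Kd M (N+1) = Kd M N + (M:ℝ)^N := by simp [Kd, Finset.sum_range_succ]
      nlinarith
    · intro j
      refine Fin.lastCases ?_ (fun j => ?_) j
      · simp only [Fin.snoc_last, Fin.val_last]
        have e2 : (n:ℝ) - y (Fin.last N) - s * ((1:ℝ)/M)^N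
            = ((n - y (Fin.last N)) * (M:ℝ)^N - s) / (M:ℝ)^N := by
          rw [one_div, inv_pow]; field_simp
        rw [e2, abs_div, abs_of_pos hP, div_le_div_iff₀ hP hM0, abs_sub_comm, abs_of_nonneg (by linarith)]
        have := Kd_le M hM N
        nlinarith
      · simpa using hw j

lemma core {N : ℕ} {κ : Type*} (Ω : (Fin N → ℝ) →ₗ[ℝ] (Fin N → ℝ) →ₗ[ℝ] ℝ)
    (hΩ : ∀ x y, Ω x y = - Ω y x)
    (hc : Continuous fun q : (Fin N → ℝ) × (Fin N → ℝ) => Ω q.1 q.2)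
    (a : (Fin N → ℝ) →ₗ[ℝ] ℝ) (ha : a ≠ 0) (Y : κ → Fin N → ℝ) :
    ∃ (w : ℕ → κ → Fin N → ℤ) (ρ : ℕ → κ → ℝ), ∀ i l,
      Tendsto (fun m => ρ m i * a (fun j => (w m l j : ℝ)) - ρ m l * a (fun j => (w m i j : ℝ))
        + Ω (fun j => (w m i j : ℝ)) (fun j => (w m l j : ℝ))) atTop (𝓝 (Ω (Y i) (Y l))) := by
  have hac : Continuous a := LinearMap.continuous_of_finiteDimensional a
  obtain ⟨j0, hj0⟩ : ∃ j0, a (Pi.single j0 1) ≠ 0 := by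
    by_contra! h
    apply ha
    apply LinearMap.pi_ext'
    intro i
    ext
    simpa using h i
  have hN : 0 < N := j0.pos
  set e0 : Fin N → ℝ := Pi.single j0 1 with he0
  let σ : Equiv.Perm (Fin N) := Equiv.swap j0 ⟨0, hN⟩
  let p : ℕ → Fin N → ℝ := fun m j => ((1:ℝ)/((m+2:ℕ):ℝ))^((σ j : Fin N):ℕ)
  have hlim0 : Tendsto (fun m:ℕ => (1:ℝ)/((m+2:ℕ):ℝ)) atTop (𝓝 0) :=
    (tendsto_one_div_atTop_nhds_zero_nat (𝕜 := ℝ)).comp (tendsto_add_atTop_nat 2)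
  have hp : Tendsto p atTop (𝓝 e0) := by
    rw [tendsto_pi_nhds]
    intro j
    by_cases hj : j = j0
    · subst hj
      have : ∀ m, p m j = 1 := fun m => by simp [p, σ]
      simp [this, he0]
    · have h0 : ((σ j : Fin N):ℕ) ≠ 0 := by
        intro h
        apply hj
        have : σ j = σ j0 := by
          apply Fin.ext
          rw [h]; simp [σ]
        exact σ.injective this
      have := hlim0.pow ((σ j : Fin N):ℕ)
      simpa [p, he0, hj, h0] using this
  let s : κ → ℝ := fun i => a (Y i) / a e0
  let y : κ → Fin N → ℝ := fun i => Y i - s i • e0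
  have hay : ∀ i, a (y i) = 0 := fun i => by
    simp only [y, s, map_sub, map_smul, smul_eq_mul]; field_simp; ring
  let lam : ℕ → ℝ := fun m => ((m+2:ℕ):ℝ) * (Kd (m+2) N + 1)
  have hlam : ∀ m, 0 < lam m := fun m => by
    have := Kd_nonneg (m+2) N
    simp only [lam]; positivity
  have hdig : ∀ m i, ∃ (S : ℝ) (w : Fin N → ℤ), lam m * s i ≤ S ∧ S ≤ lam m * s i + Kd (m+2) N ∧
      ∀ j : Fin N, |(w j : ℝ) - y i j - S * p m j| ≤ 2 / ((m+2:ℕ):ℝ) := by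
    intro m i
    obtain ⟨S, w, h1, h2, h3⟩ := digit (m+2) (by omega) N (fun j => y i (σ.symm j)) (lam m * s i)
    refine ⟨S, fun j => w (σ j), h1, h2, fun j => ?_⟩
    simpa [p] using h3 (σ j)
  choose S w hS1 hS2 hw using hdig
  let e : ℕ → κ → Fin N → ℝ := fun m i => (fun j => (w m i j : ℝ)) - y i - S m i • p m
  have hwe : ∀ m i, (fun j => (w m i j : ℝ)) = S m i • p m + (y i + e m i) := fun m i => by
    simp only [e]; abel
  have he : ∀ i, Tendsto (fun m => e m i) atTop (𝓝 0) := by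
    intro i
    rw [tendsto_pi_nhds]
    intro j
    apply squeeze_zero_norm (a := fun m:ℕ => 2 * ((1:ℝ)/((m+2:ℕ):ℝ)))
    · intro m
      have := hw m i j
      rw [mul_one_div]
      simpa [e] using this
    · simpa using hlim0.const_mul 2
  have hSl : ∀ i, Tendsto (fun m => S m i / lam m) atTop (𝓝 (s i)) := by
    intro i
    rw [tendsto_iff_norm_sub_tendsto_zero]
    apply squeeze_zero (g := fun m:ℕ => ((1:ℝ)/((m+2:ℕ):ℝ))) (fun _ => norm_nonneg _) _ hlim0
    intro m
    have hl := hlam m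
    have h1 := hS1 m i
    have h2 := hS2 m i
    have e1 : S m i / lam m - s i = (S m i - lam m * s i) / lam m := by field_simp
    have hm : (0:ℝ) < ((m+2:ℕ):ℝ) := by positivity
    rw [Real.norm_eq_abs, e1, abs_of_nonneg (div_nonneg (by linarith) hl.le), div_le_div_iff₀ hl hm]
    have : lam m = ((m+2:ℕ):ℝ) * (Kd (m+2) N + 1) := rfl
    nlinarith
  let ρ : ℕ → κ → ℝ := fun m i => (Ω (p m) (y i + e m i) - Ω (p m) (y i) / lam m) / a (p m)
  refine ⟨w, ρ, fun i l => ?_⟩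
  have hap : Tendsto (fun m => a (p m)) atTop (𝓝 (a e0)) := (hac.tendsto _).comp hp
  have hap0 : ∀ᶠ m in atTop, a (p m) ≠ 0 := hap.eventually_ne hj0
  have hye : ∀ i, Tendsto (fun m => y i + e m i) atTop (𝓝 (y i)) := fun i => by
    simpa using (he i).const_add (y i)
  have hΩt : ∀ {f g : ℕ → Fin N → ℝ} {x x' : Fin N → ℝ}, Tendsto f atTop (𝓝 x) →
      Tendsto g atTop (𝓝 x') → Tendsto (fun m => Ω (f m) (g m)) atTop (𝓝 (Ω x x')) :=
    fun {f g x x'} hf hg => (hc.tendsto (x, x')).comp (hf.prodMk_nhds hg)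
  have hlinv : Tendsto (fun m => 1 / lam m) atTop (𝓝 0) := by
    apply squeeze_zero (g := fun m:ℕ => ((1:ℝ)/((m+2:ℕ):ℝ))) (fun m => by have := hlam m; positivity) _ hlim0
    intro m
    apply one_div_le_one_div_of_le (by positivity)
    have := Kd_nonneg (m+2) N
    simp only [lam]
    have hm : (0:ℝ) < ((m+2:ℕ):ℝ) := by positivity
    nlinarith
  have hρ : ∀ i, Tendsto (fun m => ρ m i) atTop (𝓝 (Ω e0 (y i) / a e0)) := by
    intro i
    have h1 := ((hΩt hp (hye i)).sub ((hΩt hp (tendsto_const_nhds (x := y i))).mul hlinv)).div hap hj0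
    rw [mul_zero, sub_zero] at h1
    refine h1.congr (fun m => ?_)
    simp only [ρ, Pi.div_apply, mul_one_div]
  have hea : ∀ i, Tendsto (fun m => a (e m i)) atTop (𝓝 0) := fun i => by
    have h1 := (hac.tendsto _).comp (he i)
    rw [map_zero] at h1
    exact h1
  have hpy : ∀ i, Tendsto (fun m => Ω (p m) (y i)) atTop (𝓝 (Ω e0 (y i))) :=
    fun i => hΩt hp tendsto_const_nhds
  have main := ((((hpy l).mul (hSl i)).sub ((hpy i).mul (hSl l))).add
    (((hρ i).mul (hea l)).sub ((hρ l).mul (hea i)))).add (hΩt (hye i) (hye l))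
  have hself : ∀ x, Ω x x = 0 := fun x => by have := hΩ x x; linarith
  have hval : Ω e0 (y l) * s i - Ω e0 (y i) * s l + (Ω e0 (y i) / a e0 * 0 - Ω e0 (y l) / a e0 * 0)
      + Ω (y i) (y l) = Ω (Y i) (Y l) := by
    have h1 : ∀ i, Y i = s i • e0 + y i := fun i => by simp [y]
    rw [h1 i, h1 l]
    simp only [map_add, map_smul, LinearMap.add_apply, LinearMap.smul_apply, smul_eq_mul, hself e0,
      hΩ (y i) e0]
    ring
  rw [hval] at main
  refine main.congr' ?_
  filter_upwards [hap0] with m hm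
  rw [hwe m i, hwe m l]
  have hl := (hlam m).ne'
  simp only [map_add a, map_smul a, hay, smul_eq_mul]
  have h3 : Ω (S m i • p m + (y i + e m i)) (S m l • p m + (y l + e m l))
     = S m i * Ω (p m) (y l + e m l) - S m l * Ω (p m) (y i + e m i)
      + Ω (y i + e m i) (y l + e m l) := by
    generalize y i + e m i = A1
    generalize y l + e m l = A2
    simp only [map_add, map_smul, LinearMap.add_apply, LinearMap.smul_apply, smul_eq_mul,
      hself (p m), hΩ A1 (p m)]
    ring
  rw [h3]
  have h4 : ∀ i, ρ m i * a (p m) = Ω (p m) (y i + e m i) - Ω (p m) (y i) / lam m := fun i => by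
    simp only [ρ]; field_simp
  linear_combination S m i * h4 l - S m l * h4 i
/-- cast of an integer vector -/
def zc {N : ℕ} (b : Fin N → ℤ) : Fin N → ℝ := fun j => (b j : ℝ)

lemma zc_add {N : ℕ} (b c : Fin N → ℤ) : zc (b + c) = zc b + zc c := by ext; simp [zc]
lemma zc_neg {N : ℕ} (b : Fin N → ℤ) : zc (-b) = - zc b := by ext; simp [zc]
lemma zc_sub {N : ℕ} (b c : Fin N → ℤ) : zc (b - c) = zc b - zc c := by ext; simp [zc]

lemma zc_zero {N : ℕ} : zc (0 : Fin N → ℤ) = 0 := by ext; simp [zc]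

def Irr {N : ℕ} (z : Fin N → ℝ) : Prop := ∀ (b : Fin N → ℤ) (c : ℝ), zc b = c • z → c = 0

/-- integer points in the hyperplane plus the line through `z` -/
def G0 {N : ℕ} (h : Fin N → ℤ) (z : Fin N → ℝ) : AddSubgroup (Fin N → ℝ) where
  carrier := {x | ∃ (b : Fin N → ℤ) (τ : ℝ), zc h ⬝ᵥ zc b = 0 ∧ x = zc b + τ • z}
  zero_mem' := ⟨0, 0, by simp [zc_zero], by simp [zc_zero]⟩
  add_mem' := by
    rintro _ _ ⟨b, τ, hb, rfl⟩ ⟨c, τ', hc, rfl⟩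
    refine ⟨b + c, τ + τ', ?_, ?_⟩
    · rw [zc_add, dotProduct_add, hb, hc, add_zero]
    · rw [zc_add, add_smul]; abel
  neg_mem' := by
    rintro _ ⟨b, τ, hb, rfl⟩
    refine ⟨-b, -τ, ?_, ?_⟩
    · rw [zc_neg, dotProduct_neg, hb, neg_zero]
    · rw [zc_neg, neg_smul]; abel

/-- scaled orthogonal projection to the hyperplane -/
def bet {N : ℕ} (h : Fin N → ℝ) : (Fin N → ℝ) →ₗ[ℝ] (Fin N → ℝ) where
  toFun y := (h ⬝ᵥ h) • y - (h ⬝ᵥ y) • h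
  map_add' x y := by simp only [dotProduct_add, smul_add, add_smul]; abel
  map_smul' c y := by
    simp only [dotProduct_smul, RingHom.id_apply, smul_sub, smul_smul, smul_eq_mul, mul_comm]

lemma bet_apply {N : ℕ} (h y : Fin N → ℝ) : bet h y = (h ⬝ᵥ h) • y - (h ⬝ᵥ y) • h := rfl

lemma dot_bet {N : ℕ} (h y : Fin N → ℝ) : h ⬝ᵥ bet h y = 0 := by
  rw [bet_apply, dotProduct_sub, dotProduct_smul, dotProduct_smul, smul_eq_mul, smul_eq_mul]; ring

lemma bet_int {N : ℕ} (h w : Fin N → ℤ) : bet (zc h) (zc w) = zc ((h ⬝ᵥ h) • w - (h ⬝ᵥ w) • h) := by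
  ext j
  simp [bet_apply, zc, dotProduct]

lemma bet_mem {N : ℕ} (h w : Fin N → ℤ) (z : Fin N → ℝ) : bet (zc h) (zc w) ∈ G0 h z := by
  refine ⟨(h ⬝ᵥ h) • w - (h ⬝ᵥ w) • h, 0, ?_, ?_⟩
  · rw [← bet_int, dot_bet]
  · rw [bet_int]; simp

lemma line {N : ℕ} (h : Fin N → ℤ) (z : Fin N → ℝ) (hh : zc h ⬝ᵥ zc h ≠ 0) (hz : zc h ⬝ᵥ z = 0)
    (hirr : Irr z) : ∃ u : Fin N → ℝ, zc h ⬝ᵥ u = 0 ∧ (∀ c : ℝ, u ≠ c • z) ∧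
      ∀ ρ : ℝ, ρ • u ∈ closure (G0 h z : Set (Fin N → ℝ)) := by
  have hz0 : z ≠ 0 := by
    rintro rfl
    have := hirr 0 1 (by ext; simp [zc])
    simp at this
  obtain ⟨i0, hi0⟩ : ∃ i, z i ≠ 0 := by
    by_contra! hcon
    exact hz0 (funext hcon)
  set H := zc h ⬝ᵥ zc h with hH
  -- bounded sequence
  let r : ℕ → Fin N → ℤ := fun t j => ⌊t * z j / H⌋
  let fr : ℕ → Fin N → ℝ := fun t j => Int.fract (t * z j / H)
  have hfr : ∀ t, bet (zc h) (fr t) = (t:ℝ) • z - bet (zc h) (zc (r t)) := by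
    intro t
    have h1 : fr t = ((t:ℝ)/H) • z - zc (r t) := by
      ext j
      simp only [fr, r, zc, Pi.sub_apply, Pi.smul_apply, smul_eq_mul, Int.fract]
      ring_nf
    rw [h1, map_sub, map_smul, bet_apply (zc h) z, hz, zero_smul, sub_zero, ← hH, smul_smul]
    congr 2
    field_simp
  have hcb : Continuous (bet (zc h)) := LinearMap.continuous_of_finiteDimensional _
  obtain ⟨f0, -, φ, hφ, hlim⟩ := tendsto_subseq_of_bounded (x := fr) (s := Set.Icc 0 1)
    (Metric.isBounded_Icc _ _) (fun t => ⟨Pi.le_def.2 fun j => Int.fract_nonneg _, Pi.le_def.2 fun j => (Int.fract_lt_one _).le⟩)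
  let δ : ℕ → Fin N → ℝ := fun m => bet (zc h) (fr (φ (m+1))) - bet (zc h) (fr (φ m))
  have hδ : Tendsto δ atTop (𝓝 0) := by
    have h1 := (hcb.tendsto f0).comp hlim
    have h2 := (h1.comp (tendsto_add_atTop_nat 1)).sub h1
    rw [sub_self] at h2
    exact h2
  let P : (Fin N → ℝ) →ₗ[ℝ] (Fin N → ℝ) :=
    LinearMap.id - ((z i0)⁻¹ • (LinearMap.proj i0 : (Fin N → ℝ) →ₗ[ℝ] ℝ)).smulRight z
  have hP : ∀ x, P x = x - ((z i0)⁻¹ * x i0) • z := fun x => by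
    simp [P]
  have hcP : Continuous P := LinearMap.continuous_of_finiteDimensional _
  let x : ℕ → Fin N → ℝ := fun m => P (δ m)
  have hx : Tendsto x atTop (𝓝 0) := by
    have := (hcP.tendsto 0).comp hδ
    rw [map_zero] at this
    exact this
  have hδm : ∀ m, δ m ∈ G0 h z := by
    intro m
    have hzm : ∀ c : ℝ, c • z ∈ G0 h z := fun c => ⟨0, c, by simp [zc_zero], by simp [zc_zero]⟩
    simp only [δ, hfr]
    exact sub_mem (sub_mem (hzm _) (bet_mem _ _ _)) (sub_mem (hzm _) (bet_mem _ _ _))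
  have hPm : ∀ y ∈ G0 h z, P y ∈ G0 h z := by
    intro y hy
    rw [hP]
    exact sub_mem hy ⟨0, (z i0)⁻¹ * y i0, by simp [zc_zero], by simp [zc_zero]⟩
  have hxne : ∀ᶠ m in atTop, x m ≠ 0 := by
    have : ∀ᶠ m in atTop, ‖δ m‖ < ‖z‖ := by
      have := hδ.norm
      rw [norm_zero] at this
      exact this.eventually_lt_const (norm_pos_iff.2 hz0)
    filter_upwards [this] with m hm h0
    have h1 : P (δ m) = 0 := h0
    rw [hP, sub_eq_zero] at h1
    set c := (z i0)⁻¹ * δ m i0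
    have h2 : δ m = ((φ (m+1):ℝ) - φ m) • z - (bet (zc h) (zc (r (φ (m+1)))) - bet (zc h) (zc (r (φ m)))) := by
      simp only [δ, hfr, sub_smul]; abel
    rw [bet_int, bet_int, ← zc_sub] at h2
    have h3 := hirr _ ((φ (m+1):ℝ) - φ m - c) (by rw [sub_smul _ c, ← h1, h2]; abel)
    have h4 : (φ m : ℝ) + 1 ≤ φ (m+1) := by exact_mod_cast hφ (Nat.lt_succ_self m)
    have h5 : 1 ≤ c := by linarith
    rw [h1, norm_smul, Real.norm_eq_abs, abs_of_nonneg (by linarith)] at hm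
    have := norm_pos_iff.2 hz0
    nlinarith
  obtain ⟨m0, hm0⟩ := eventually_atTop.1 hxne
  let x' : ℕ → Fin N → ℝ := fun m => x (m + m0)
  have hx' : Tendsto x' atTop (𝓝 0) := hx.comp (tendsto_add_atTop_nat m0)
  have hx'0 : ∀ m, x' m ≠ 0 := fun m => hm0 _ (by omega)
  have hx'm : ∀ m, x' m ∈ G0 h z := fun m => hPm _ (hδm _)
  obtain ⟨u, hu, ψ, hψ, hlu⟩ := (isCompact_sphere (0 : Fin N → ℝ) 1).tendsto_subseq
    (x := fun m => ‖x' m‖⁻¹ • x' m) (fun m => by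
      have := norm_pos_iff.2 (hx'0 m)
      simp [norm_smul, this.ne'])
  have hun : ‖u‖ = 1 := by simpa using hu
  have hxψ : Tendsto (fun m => x' (ψ m)) atTop (𝓝 0) := hx'.comp hψ.tendsto_atTop
  refine ⟨u, ?_, ?_, ?_⟩
  · have hc1 : Continuous fun y : Fin N → ℝ => zc h ⬝ᵥ y := by fun_prop
    have h1 := (hc1.tendsto u).comp hlu
    refine tendsto_nhds_unique h1 ?_
    refine tendsto_const_nhds.congr (fun m => ?_)
    obtain ⟨b, τ, hb, hbe⟩ := hx'm (ψ m)
    simp [hbe, hb, hz]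
  · rintro c rfl
    have h1 := (tendsto_pi_nhds.1 hlu) i0
    have h2 : (c • z) i0 = 0 := by
      refine tendsto_nhds_unique h1 (tendsto_const_nhds.congr (fun m => ?_))
      have h9 : x' (ψ m) i0 = 0 := by
        simp only [x', x, hP, Pi.sub_apply, Pi.smul_apply, smul_eq_mul]
        field_simp
        ring
      simp [h9]
    have : c = 0 := by simpa [hi0] using h2
    simp [this] at hun
  · intro ρ
    refine mem_closure_of_tendsto (f := fun m => ⌊ρ / ‖x' (ψ m)‖⌋ • x' (ψ m)) (b := atTop) ?_
      (Eventually.of_forall fun m => zsmul_mem (hx'm _) _)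
    have h1 : Tendsto (fun m => ρ • (‖x' (ψ m)‖⁻¹ • x' (ψ m))) atTop (𝓝 (ρ • u)) := hlu.const_smul ρ
    have h2 : Tendsto (fun m => Int.fract (ρ / ‖x' (ψ m)‖) • x' (ψ m)) atTop (𝓝 0) := by
      apply squeeze_zero_norm (a := fun m => ‖x' (ψ m)‖)
      · intro m
        rw [norm_smul, Real.norm_eq_abs, abs_of_nonneg (Int.fract_nonneg _)]
        exact mul_le_of_le_one_left (norm_nonneg _) (Int.fract_lt_one _).le
      · simpa using hxψ.norm
    have h3 := h1.sub h2
    rw [sub_zero] at h3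
    refine h3.congr (fun m => ?_)
    rw [← Int.cast_smul_eq_zsmul ℝ, smul_smul, ← sub_smul, ← div_eq_mul_inv, Int.self_sub_fract]


def Gam {N k : ℕ} (A : Matrix (Fin N) (Fin N) ℝ) (X : Fin k → Fin N → ℝ) : Pairs k → ℝ :=
  fun p => X p.1.1 ⬝ᵥ (A *ᵥ X p.1.2)

def SS {N : ℕ} (k : ℕ) (A : Matrix (Fin N) (Fin N) ℝ) : Set (Pairs k → ℝ) :=
  {t | ∃ v : Fin k → Fin N → ℤ, t = Gam A (fun i => zc (v i))}

lemma Gam_cont {N k : ℕ} (A : Matrix (Fin N) (Fin N) ℝ) : Continuous (Gam (k := k) A) := by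
  unfold Gam
  fun_prop

lemma alt_form {N : ℕ} (A : Matrix (Fin N) (Fin N) ℝ) (halt : Aᵀ = -A) (x y : Fin N → ℝ) :
    x ⬝ᵥ (A *ᵥ y) = - (y ⬝ᵥ (A *ᵥ x)) := by
  rw [dotProduct_mulVec, ← mulVec_transpose, halt, neg_mulVec, neg_dotProduct, dotProduct_comm]

lemma mainH {N k : ℕ} (A : Matrix (Fin N) (Fin N) ℝ) (halt : Aᵀ = -A)
    (hinj : ∀ x, A *ᵥ x = 0 → x = 0) (h : Fin N → ℤ) (z : Fin N → ℝ) (hz : A *ᵥ z = zc h)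
    (hh : zc h ⬝ᵥ zc h ≠ 0) (hirr : Irr z) (X : Fin k → Fin N → ℝ) (hX : ∀ i, zc h ⬝ᵥ X i = 0) :
    Gam A X ∈ closure (SS k A) := by
  have hself : ∀ x : Fin N → ℝ, x ⬝ᵥ (A *ᵥ x) = 0 := fun x => by
    have := alt_form A halt x x; linarith
  have hz0 : zc h ⬝ᵥ z = 0 := by rw [← hz, dotProduct_comm, hself]
  obtain ⟨u, hu, huz, hline⟩ := line h z hh hz0 hirr
  -- Gram of closure elements
  have hclos : ∀ g : Fin k → Fin N → ℝ, (∀ i, g i ∈ closure (G0 h z : Set (Fin N → ℝ))) →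
      Gam A g ∈ closure (SS k A) := by
    intro g hg
    have h1 : g ∈ closure (Set.pi Set.univ fun _ : Fin k => (G0 h z : Set (Fin N → ℝ))) := by
      rw [closure_pi_set]
      exact fun i _ => hg i
    refine map_mem_closure (Gam_cont A) h1 ?_
    intro g' hg'
    have hg2 : ∀ i, ∃ (b : Fin N → ℤ) (τ : ℝ), zc h ⬝ᵥ zc b = 0 ∧ g' i = zc b + τ • z :=
      fun i => hg' i trivial
    choose b τ hb hg3 using hg2
    refine ⟨b, ?_⟩
    funext p
    have e1 : ∀ i, zc (b i) ⬝ᵥ (A *ᵥ z) = 0 := fun i => by rw [hz, dotProduct_comm, hb]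
    have e2 : ∀ i, z ⬝ᵥ (A *ᵥ zc (b i)) = 0 := fun i => by rw [alt_form A halt, e1, neg_zero]
    simp [Gam, hg3, mulVec_add, mulVec_smul, e1, e2, hself z]
  let F : (Fin N → ℝ) →ₗ[ℝ] (Fin N → ℝ) →ₗ[ℝ] ℝ := Matrix.toLinearMap₂' ℝ A
  have hF : ∀ x y, F x y = x ⬝ᵥ (A *ᵥ y) := fun x y => by
    simp [F, Matrix.toLinearMap₂'_apply']
  let B := bet (zc h)
  have hcB : Continuous B := LinearMap.continuous_of_finiteDimensional _
  let Ω : (Fin N → ℝ) →ₗ[ℝ] (Fin N → ℝ) →ₗ[ℝ] ℝ := F.compl₁₂ B B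
  have hΩ : ∀ x y, Ω x y = B x ⬝ᵥ (A *ᵥ B y) := fun x y => by simp [Ω, hF]
  let a := (F u).comp B
  have ha : ∀ x, a x = u ⬝ᵥ (A *ᵥ B x) := fun x => by simp [a, hF]
  have ha0 : a ≠ 0 := by
    intro h0
    have h1 : ∀ y, B y ⬝ᵥ (A *ᵥ u) = 0 := fun y => by
      rw [alt_form A halt, ← ha, h0]; simp
    have h2 : B (A *ᵥ u) = 0 := by
      rw [← dotProduct_eq_zero_iff]
      intro y
      have := h1 y
      simp only [B, bet_apply, sub_dotProduct, smul_dotProduct, smul_eq_mul] at this ⊢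
      rw [dotProduct_comm (A *ᵥ u) y]
      linarith
    simp only [B, bet_apply] at h2
    apply huz ((zc h ⬝ᵥ (A *ᵥ u)) / (zc h ⬝ᵥ zc h))
    rw [← sub_eq_zero]
    apply hinj
    rw [mulVec_sub, mulVec_smul, hz]
    have : A *ᵥ u - ((zc h ⬝ᵥ (A *ᵥ u)) / (zc h ⬝ᵥ zc h)) • zc h
      = (zc h ⬝ᵥ zc h)⁻¹ • ((zc h ⬝ᵥ zc h) • (A *ᵥ u) - (zc h ⬝ᵥ (A *ᵥ u)) • zc h) := by
      rw [smul_sub, smul_smul, inv_mul_cancel₀ hh, one_smul, smul_smul, div_eq_inv_mul]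
    rw [this, h2, smul_zero]
  let Y : Fin k → Fin N → ℝ := fun i => (zc h ⬝ᵥ zc h)⁻¹ • X i
  have hY : ∀ i, B (Y i) = X i := fun i => by
    simp only [Y, map_smul, B, bet_apply, hX]
    rw [zero_smul, sub_zero, smul_smul, inv_mul_cancel₀ hh, one_smul]
  obtain ⟨w, ρ, hlim⟩ := core Ω (fun x y => by rw [hΩ, hΩ]; exact alt_form A halt _ _)
    (by simp only [hΩ]; fun_prop) a ha0 Y
  rw [← closure_closure]
  refine mem_closure_of_tendsto (b := atTop)
    (f := fun m => Gam A (fun i => ρ m i • u + B (zc (w m i)))) ?_ (Eventually.of_forall fun m => ?_)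
  · rw [tendsto_pi_nhds]
    intro p
    have h1 := hlim p.1.1 p.1.2
    rw [hΩ, hY, hY] at h1
    refine h1.congr (fun m => ?_)
    rw [hΩ, ha, ha]
    change ρ m p.1.1 * (u ⬝ᵥ (A *ᵥ B (zc (w m p.1.2)))) - ρ m p.1.2 * (u ⬝ᵥ (A *ᵥ B (zc (w m p.1.1))))
      + B (zc (w m p.1.1)) ⬝ᵥ (A *ᵥ B (zc (w m p.1.2)))
      = (ρ m p.1.1 • u + B (zc (w m p.1.1))) ⬝ᵥ (A *ᵥ (ρ m p.1.2 • u + B (zc (w m p.1.2))))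
    simp only [mulVec_add, mulVec_smul, add_dotProduct, dotProduct_add, smul_dotProduct,
      dotProduct_smul, smul_eq_mul, hself u, alt_form A halt (B (zc (w m p.1.1))) u]
    ring
  · apply hclos
    intro i
    have := (G0 h z).topologicalClosure.add_mem (x := ρ m i • u) (y := B (zc (w m i)))
      (hline _) ((G0 h z).le_topologicalClosure (bet_mem h _ z))
    exact this

lemma rat_step {N : ℕ} (b0 b1 b2 : Fin N → ℚ) (c0 c1 c2 : ℝ) (hc0 : c0 ≠ 0) (hb0 : b0 ≠ 0)
    (h : ∀ i, c0 * (b0 i : ℝ) + c1 * b1 i = c2 * b2 i) :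
    (∃ μ : ℝ, ∀ i, c1 * (b1 i : ℝ) = μ * (c0 * b0 i)) ∨ ∃ r : ℚ, c1 = r * c0 := by
  by_cases hd : ∃ i j, b0 i * b1 j - b0 j * b1 i ≠ 0
  · right
    obtain ⟨i, j, hd⟩ := hd
    have hd' : ((b0 i * b1 j - b0 j * b1 i : ℚ) : ℝ) ≠ 0 := by exact_mod_cast hd
    push_cast at hd'
    have e0 : c0 * ((b0 i:ℝ) * b1 j - b0 j * b1 i) = c2 * (b2 i * b1 j - b2 j * b1 i) := by
      linear_combination (b1 j : ℝ) * h i - (b1 i : ℝ) * h j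
    have e1 : c1 * ((b0 i:ℝ) * b1 j - b0 j * b1 i) = c2 * (b0 i * b2 j - b0 j * b2 i) := by
      linear_combination (b0 i : ℝ) * h j - (b0 j : ℝ) * h i
    have hne : ((b2 i:ℝ) * b1 j - b2 j * b1 i) ≠ 0 := by
      intro h0
      rw [h0, mul_zero] at e0
      exact mul_ne_zero hc0 hd' e0
    refine ⟨(b0 i * b2 j - b0 j * b2 i) / (b2 i * b1 j - b2 j * b1 i), ?_⟩
    push_cast
    rw [div_mul_eq_mul_div, eq_div_iff hne]
    apply mul_right_cancel₀ hd'
    linear_combination ((b2 i:ℝ) * b1 j - b2 j * b1 i) * e1 - (b0 i * b2 j - b0 j * b2 i) * e0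
  · left
    push Not at hd
    obtain ⟨i, hi⟩ : ∃ i, b0 i ≠ 0 := by
      by_contra! hcon
      exact hb0 (funext hcon)
    have hi' : (b0 i : ℝ) ≠ 0 := by exact_mod_cast hi
    refine ⟨c1 * b1 i / (c0 * b0 i), fun j => ?_⟩
    have : (b0 i : ℝ) * b1 j - b0 j * b1 i = 0 := by exact_mod_cast hd i j
    field_simp
    linear_combination c1 * this

/-- cast of rational vectors -/
def qc {N : ℕ} (b : Fin N → ℚ) : Fin N → ℝ := fun j => (b j : ℝ)

lemma rat_matrix {N : ℕ} (B : Matrix (Fin N) (Fin N) ℝ) (hB : ∀ x, B *ᵥ x = 0 → x = 0)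
    (f : Fin N → ℝ) (hf : f ≠ 0) (U : Set (Fin N → ℝ)) (hU : IsOpen U) (hfU : f ∈ U)
    (hr : ∀ q : Fin N → ℚ, qc q ∈ U → ∃ (b : Fin N → ℚ) (c : ℝ), c ≠ 0 ∧ B *ᵥ qc q = c • qc b) :
    ∃ c : ℝ, c ≠ 0 ∧ ∃ Q : Matrix (Fin N) (Fin N) ℚ, ∀ i j, B i j = c * (Q i j : ℝ) := by
  have hdense : DenseRange (qc (N := N)) := by
    have : DenseRange (Pi.map (fun _ : Fin N => ((↑) : ℚ → ℝ))) :=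
      DenseRange.piMap (fun _ => Rat.denseRange_cast)
    exact this
  obtain ⟨q0, hq0U, hq0⟩ : ∃ q, qc q ∈ U ∧ qc q ≠ 0 := by
    obtain ⟨q, hq⟩ := hdense.exists_mem_open (hU.inter (isOpen_ne (x := (0 : Fin N → ℝ)))) ⟨f, hfU, hf⟩
    exact ⟨q, hq.1, hq.2⟩
  obtain ⟨b0, c0, hc0, hB0⟩ := hr q0 hq0U
  have hb0 : b0 ≠ 0 := by
    rintro rfl
    apply hq0
    apply hB
    rw [hB0]; ext; simp [qc]
  have hcol : ∀ j, ∃ r : Fin N → ℚ, ∀ i, B i j = c0 * (r i : ℝ) := by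
    intro j
    obtain ⟨t, ht0, ht1, ht2⟩ : ∃ t : ℚ, t ≠ 0 ∧ qc (q0 + t • Pi.single j 1) ∈ U ∧
        qc (q0 + (t/2) • Pi.single j 1) ∈ U := by
      let γ : ℝ → Fin N → ℝ := fun s => qc q0 + s • Pi.single j 1
      have hγ : Continuous γ := by fun_prop
      have hγc : ∀ s : ℚ, qc (q0 + s • Pi.single j 1) = γ s := fun s => by
        ext i
        by_cases hij : i = j
        · subst hij; simp [qc, γ]
        · simp [qc, γ, hij]
      have h0 : γ ⁻¹' U ∈ 𝓝 (0:ℝ) := hγ.continuousAt.preimage_mem_nhds (by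
        simpa [γ] using hU.mem_nhds hq0U)
      obtain ⟨ε, hε, hb⟩ := Metric.mem_nhds_iff.1 h0
      obtain ⟨t, ht, ht'⟩ := exists_rat_btwn hε
      refine ⟨t, ?_, ?_, ?_⟩
      · rintro rfl; simp at ht
      · rw [hγc]; apply hb
        rw [Metric.mem_ball, dist_zero_right, Real.norm_eq_abs, abs_of_pos ht]; exact ht'
      · rw [hγc]; apply hb; push_cast
        rw [Metric.mem_ball, dist_zero_right, Real.norm_eq_abs, abs_of_pos (by linarith)]; linarith
    obtain ⟨b1, c1, hc1, hB1⟩ := hr _ ht1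
    obtain ⟨b2, c2, hc2, hB2⟩ := hr _ ht2
    have hsplit : ∀ s : ℚ, qc (q0 + s • Pi.single j 1) = qc q0 + (s:ℝ) • Pi.single j 1 := fun s => by
      ext i
      by_cases hij : i = j
      · subst hij; simp [qc]
      · simp [qc, hij]
    have hE : ∀ s : ℚ, ∀ i, (B *ᵥ qc (q0 + s • Pi.single j 1)) i = c0 * b0 i + s * B i j := by
      intro s i
      rw [hsplit, mulVec_add, mulVec_smul, hB0]
      simp [qc]
    have h1 : ∀ i, c0 * b0 i + t * B i j = c1 * b1 i := fun i => by
      rw [← hE, hB1]; simp [qc]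
    have h2 : ∀ i, c0 * b0 i + (t/2) * B i j = c2 * b2 i := fun i => by
      have := hE (t/2) i
      rw [hB2] at this
      push_cast at this
      rw [← this]; simp [qc]
    have ht0' : (t:ℝ) ≠ 0 := by exact_mod_cast ht0
    rcases rat_step b0 b1 b2 c0 c1 (2*c2) hc0 hb0 (fun i => by linear_combination 2 * h2 i - h1 i) with
      ⟨μ, hμ⟩ | ⟨r, hr⟩
    · have hq1 : qc (q0 + t • Pi.single j 1) = μ • qc q0 := by
        rw [← sub_eq_zero]
        apply hB
        rw [mulVec_sub, mulVec_smul, hB0, hB1]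
        ext i
        have := hμ i
        simp only [qc, Pi.sub_apply, Pi.smul_apply, smul_eq_mul, Pi.zero_apply]
        linarith
      obtain ⟨i0, hi0⟩ : ∃ i, qc q0 i ≠ 0 := by
        by_contra! hcon
        exact hq0 (funext hcon)
      have hi0' : (q0 i0 : ℝ) ≠ 0 := hi0
      have hμr : μ = (((q0 + t • Pi.single j 1 : Fin N → ℚ) i0 / q0 i0 : ℚ) : ℝ) := by
        have := congrFun hq1 i0
        simp only [Pi.smul_apply, smul_eq_mul] at this
        rw [Rat.cast_div, eq_div_iff hi0']
        exact this.symm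
      set m : ℚ := (q0 + t • Pi.single j 1 : Fin N → ℚ) i0 / q0 i0
      refine ⟨fun i => (m - 1) * b0 i / t, fun i => ?_⟩
      push_cast
      field_simp
      have := hμ i
      rw [hμr] at this
      linear_combination h1 i + this
    · refine ⟨fun i => (r * b1 i - b0 i) / t, fun i => ?_⟩
      push_cast
      field_simp
      have := h1 i
      rw [hr] at this
      linear_combination this
  choose r hr' using hcol
  exact ⟨c0, hc0, fun i j => r j i, fun i j => hr' j i⟩

def RatM {N : ℕ} (A : Matrix (Fin N) (Fin N) ℝ) : Prop :=
  ∃ c : ℝ, c ≠ 0 ∧ ∀ i j, ∃ m : ℤ, c * A i j = (m : ℝ)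

lemma ratM_of_inv {N : ℕ} (A B : Matrix (Fin N) (Fin N) ℝ) (hAB : A * B = 1) (c : ℝ) (hc : c ≠ 0)
    (Q : Matrix (Fin N) (Fin N) ℚ) (hQ : ∀ i j, B i j = c * (Q i j : ℝ)) : RatM A := by
  let R := Q.map (Rat.castHom ℝ)
  have hBR : B = c • R := by ext i j; simp [R, hQ]
  have h1 : (c • A) * R = 1 := by rw [← hAB, hBR, Matrix.smul_mul, Matrix.mul_smul]
  have hdet : Q.det ≠ 0 := by
    intro h0
    have h2 := congrArg Matrix.det h1
    have h3 : R.det = (Rat.castHom ℝ) Q.det := ((Rat.castHom ℝ).map_det Q).symm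
    rw [det_mul, h3, h0, map_zero, mul_zero, det_one] at h2
    exact zero_ne_one h2
  have h4 : Q * Q⁻¹ = 1 := mul_nonsing_inv _ (isUnit_iff_ne_zero.2 hdet)
  have h5 : R * (Q⁻¹).map (Rat.castHom ℝ) = 1 := by
    rw [← Matrix.map_mul, h4]; simp
  have h6 : c • A = (Q⁻¹).map (Rat.castHom ℝ) := by
    calc c • A = (c • A) * (R * (Q⁻¹).map (Rat.castHom ℝ)) := by rw [h5, mul_one]
      _ = _ := by rw [← mul_assoc, h1, one_mul]
  let D : ℕ := ∏ i, ∏ j, (Q⁻¹ i j).den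
  have hD : D ≠ 0 := Finset.prod_ne_zero_iff.2 fun i _ => Finset.prod_ne_zero_iff.2 fun j _ => (Q⁻¹ i j).den_nz
  refine ⟨D * c, mul_ne_zero (by exact_mod_cast hD) hc, fun i j => ?_⟩
  have h7 : c * A i j = ((Q⁻¹ i j : ℚ) : ℝ) := by
    have := congrFun (congrFun h6 i) j
    simpa using this
  have h8 : (Q⁻¹ i j).den ∣ D :=
    (Finset.dvd_prod_of_mem (fun j => (Q⁻¹ i j).den) (Finset.mem_univ j)).trans
      (Finset.dvd_prod_of_mem (fun i => ∏ j, (Q⁻¹ i j).den) (Finset.mem_univ i))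
  obtain ⟨e, he⟩ := h8
  refine ⟨e * (Q⁻¹ i j).num, ?_⟩
  have h9 : ((Q⁻¹ i j : ℚ) : ℝ) * ((Q⁻¹ i j).den : ℝ) = ((Q⁻¹ i j).num : ℝ) := by
    exact_mod_cast Rat.mul_den_eq_num (Q⁻¹ i j)
  rw [mul_assoc, h7, he]
  push_cast
  rw [← h9]
  ring

lemma good_dense {N : ℕ} (A B : Matrix (Fin N) (Fin N) ℝ) (hAB : A * B = 1)
    (hA : ¬ RatM A) (f : Fin N → ℝ) (hf : f ≠ 0) :
    f ∈ closure {y : Fin N → ℝ | y ≠ 0 ∧ ∃ (h : Fin N → ℤ) (c : ℝ), c ≠ 0 ∧ y = c • zc h ∧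
      Irr (B *ᵥ zc h)} := by
  by_contra hcon
  rw [mem_closure_iff] at hcon
  push Not at hcon
  obtain ⟨U, hU, hfU, hemp⟩ := hcon
  apply hA
  have hB : ∀ x, B *ᵥ x = 0 → x = 0 := fun x hx => by
    have : A *ᵥ (B *ᵥ x) = 0 := by rw [hx, mulVec_zero]
    simpa [mulVec_mulVec, hAB] using this
  obtain ⟨c, hc, Q, hQ⟩ := rat_matrix B hB f hf (U ∩ {0}ᶜ) (hU.inter isOpen_compl_singleton)
    ⟨hfU, hf⟩ (by
      intro q hq
      let D : ℕ := ∏ j, (q j).den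
      have hD : D ≠ 0 := Finset.prod_ne_zero_iff.2 fun j _ => (q j).den_nz
      have hD' : (D:ℝ) ≠ 0 := by exact_mod_cast hD
      have hex : ∀ j, ∃ m : ℤ, (D:ℝ) * q j = m := by
        intro j
        obtain ⟨e, he⟩ := Finset.dvd_prod_of_mem (fun j => (q j).den) (Finset.mem_univ j)
        refine ⟨e * (q j).num, ?_⟩
        have h9 : ((q j : ℚ) : ℝ) * ((q j).den : ℝ) = ((q j).num : ℝ) := by
          exact_mod_cast Rat.mul_den_eq_num (q j)
        change ((∏ j, (q j).den : ℕ):ℝ) * _ = _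
        rw [he]
        push_cast
        rw [← h9]; ring
      choose h hh using hex
      have hqh : qc q = (D:ℝ)⁻¹ • zc h := by
        ext j; simp [qc, zc, ← hh, hD']
      by_cases hI : Irr (B *ᵥ zc h)
      · have : qc q ∈ (∅ : Set (Fin N → ℝ)) := by
          rw [← hemp]
          exact ⟨hq.1, hq.2, h, (D:ℝ)⁻¹, inv_ne_zero hD', hqh, hI⟩
        exact this.elim
      · unfold Irr at hI
        push Not at hI
        obtain ⟨b, c, hbc, hc⟩ := hI
        refine ⟨fun j => b j, (D:ℝ)⁻¹ * c⁻¹, mul_ne_zero (inv_ne_zero hD') (inv_ne_zero hc), ?_⟩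
        have h1 : qc (fun j => ((b j : ℤ):ℚ)) = zc b := by ext; simp [qc, zc]
        rw [h1, hbc, hqh, mulVec_smul, smul_smul, mul_assoc, inv_mul_cancel₀ hc, mul_one])
  exact ratM_of_inv A B hAB c hc Q hQ

lemma dense_main {N k : ℕ} (hk : k < N) (A B : Matrix (Fin N) (Fin N) ℝ) (halt : Aᵀ = -A)
    (hAB : A * B = 1) (hBA : B * A = 1) (hA : ¬ RatM A) (X : Fin k → Fin N → ℝ) :
    Gam A X ∈ closure (SS k A) := by
  have hinj : ∀ x, A *ᵥ x = 0 → x = 0 := fun x hx => by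
    have : B *ᵥ (A *ᵥ x) = 0 := by rw [hx, mulVec_zero]
    simpa [mulVec_mulVec, hBA] using this
  obtain ⟨f, hf, hfX⟩ : ∃ f : Fin N → ℝ, f ≠ 0 ∧ ∀ i, f ⬝ᵥ X i = 0 := by
    let L := Matrix.toLin' (Matrix.of X)
    have hker : LinearMap.ker L ≠ ⊥ := LinearMap.ker_ne_bot_of_finrank_lt (by simpa using hk)
    obtain ⟨f, hfk, hf⟩ := (Submodule.ne_bot_iff _).1 hker
    refine ⟨f, hf, fun i => ?_⟩
    have h1 : L f = 0 := hfk
    have := congrFun h1 i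
    rw [dotProduct_comm]
    simpa [L, mulVec] using this
  have hcl := good_dense A B hAB hA f hf
  have hff : f ⬝ᵥ f ≠ 0 := by simpa using hf
  let Ψ : (Fin N → ℝ) → Fin k → Fin N → ℝ := fun y i => X i - ((y ⬝ᵥ X i) / (y ⬝ᵥ y)) • y
  have hΨ : ContinuousAt Ψ f := by
    rw [continuousAt_pi]
    intro i
    apply ContinuousAt.sub continuousAt_const
    have c1 : Continuous fun y : Fin N → ℝ => y ⬝ᵥ X i := by fun_prop
    have c2 : Continuous fun y : Fin N → ℝ => y ⬝ᵥ y := by fun_prop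
    exact (c1.continuousAt.div c2.continuousAt hff).smul (f := fun y => (y ⬝ᵥ X i) / (y ⬝ᵥ y))
      (g := fun y => y) continuousAt_id
  have hΨf : Ψ f = X := by
    funext i; simp [Ψ, hfX]
  have h1 : ContinuousAt (fun y => Gam A (Ψ y)) f := (Gam_cont A).continuousAt.comp hΨ
  have h2 := h1.continuousWithinAt.mem_closure hcl (t := closure (SS k A)) (by
    rintro y ⟨hy0, h, c, hc, rfl, hI⟩
    have hh0 : zc h ≠ 0 := fun h0 => hy0 (by rw [h0, smul_zero])
    refine mainH A halt hinj h (B *ᵥ zc h) (by rw [mulVec_mulVec, hAB, one_mulVec])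
      (by simpa using hh0) hI _ (fun i => ?_)
    have hy : (c • zc h) ⬝ᵥ (c • zc h) ≠ 0 := by simpa using hy0
    have h3 : (c • zc h) ⬝ᵥ Ψ (c • zc h) i = 0 := by
      simp only [Ψ]
      rw [dotProduct_sub, dotProduct_smul, smul_eq_mul, div_mul_cancel₀ _ hy, sub_self]
    rw [smul_dotProduct, smul_eq_mul] at h3
    exact (mul_eq_zero.1 h3).resolve_left hc)
  rw [closure_closure] at h2
  simpa [hΨf] using h2

lemma Jmat_mul (n : ℕ) : Jmat n * Jmat n = -1 := by
  ext i j
  rw [Matrix.mul_apply]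
  by_cases hi : (i:ℕ) < n
  · have hl : (i:ℕ) + n < 2 * n := by omega
    rw [Finset.sum_eq_single (⟨(i:ℕ) + n, hl⟩ : Fin (2*n))]
    · simp only [Jmat, Matrix.neg_apply, Matrix.one_apply, Fin.ext_iff]
      split_ifs <;> first | omega | norm_num
    · intro l _ hne
      have hne' : (l:ℕ) ≠ i + n := fun h => hne (Fin.ext h)
      have : Jmat n i l = 0 := by
        simp only [Jmat]
        split_ifs <;> first | omega | rfl
      rw [this, zero_mul]
    · simp
  · have hl : (i:ℕ) - n < 2 * n := by omega
    have hi2 := i.isLt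
    rw [Finset.sum_eq_single (⟨(i:ℕ) - n, hl⟩ : Fin (2*n))]
    · simp only [Jmat, Matrix.neg_apply, Matrix.one_apply, Fin.ext_iff]
      split_ifs <;> first | omega | norm_num
    · intro l _ hne
      have hne' : (l:ℕ) ≠ i - n := fun h => hne (Fin.ext h)
      have hl2 := l.isLt
      have : Jmat n i l = 0 := by
        simp only [Jmat]
        split_ifs <;> first | omega | rfl
      rw [this, zero_mul]
    · simp

lemma Jmat_transpose (n : ℕ) (hn : 0 < n) : (Jmat n)ᵀ = - Jmat n := by
  ext i j
  simp only [Jmat, Matrix.transpose_apply, Matrix.neg_apply]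
  split_ifs <;> first | omega | norm_num

def AA (n : ℕ) (g : SL2n n) : Matrix (Fin (2*n)) (Fin (2*n)) ℝ :=
  (g : Matrix (Fin (2*n)) (Fin (2*n)) ℝ)ᵀ * Jmat n * (g : Matrix (Fin (2*n)) (Fin (2*n)) ℝ)

lemma AA_form (n : ℕ) (g : SL2n n) (v w : Fin (2*n) → ℝ) :
    sympG n g v w = v ⬝ᵥ (AA n g *ᵥ w) := by
  unfold sympG symp AA
  rw [← mulVec_mulVec, ← mulVec_mulVec, dotProduct_mulVec v, vecMul_transpose]

lemma AA_alt (n : ℕ) (hn : 0 < n) (g : SL2n n) : (AA n g)ᵀ = - AA n g := by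
  unfold AA
  rw [transpose_mul, transpose_mul, Jmat_transpose n hn, transpose_transpose]
  simp [mul_assoc]

lemma AA_unit (n : ℕ) (g : SL2n n) : IsUnit (AA n g).det := by
  have hJ : IsUnit (Jmat n).det :=
    isUnit_det_of_right_inverse (B := - Jmat n) (by rw [mul_neg, Jmat_mul, neg_neg])
  unfold AA
  rw [det_mul, det_mul, det_transpose]
  simpa using hJ

lemma not_dense {N k : ℕ} (hN : 0 < N) (hk2 : 2 ≤ k) (A B : Matrix (Fin N) (Fin N) ℝ)
    (hBA : B * A = 1) (hA : RatM A) : ∃ X : Fin k → Fin N → ℝ, Gam A X ∉ closure (SS k A) := by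
  obtain ⟨c, hc, hint⟩ := hA
  let e : Fin N → ℝ := Pi.single ⟨0, hN⟩ 1
  have he : e ≠ 0 := by simp [e]
  have hAe : A *ᵥ e ≠ 0 := fun h => he (by
    have : B *ᵥ (A *ᵥ e) = 0 := by rw [h, mulVec_zero]
    simpa [mulVec_mulVec, hBA] using this)
  have hd : (A *ᵥ e) ⬝ᵥ (A *ᵥ e) ≠ 0 := by simpa using hAe
  let x : Fin N → ℝ := (1 / (2 * c * ((A *ᵥ e) ⬝ᵥ (A *ᵥ e)))) • (A *ᵥ e)
  let i0 : Fin k := ⟨0, by omega⟩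
  let i1 : Fin k := ⟨1, by omega⟩
  let P : Pairs k := ⟨(i0, i1), by simp [i0, i1, Fin.lt_def]⟩
  refine ⟨fun i => if i = i0 then x else e, fun hcl => ?_⟩
  have hclosed : IsClosed {t : Pairs k → ℝ | c * t P ∈ Set.range ((↑) : ℤ → ℝ)} := by
    have h1 : IsClosed (Set.range ((↑) : ℤ → ℝ)) := Int.isClosedEmbedding_coe_real.isClosed_range
    exact h1.preimage (by fun_prop : Continuous fun t : Pairs k → ℝ => c * t P)
  have hsub : SS k A ⊆ {t : Pairs k → ℝ | c * t P ∈ Set.range ((↑) : ℤ → ℝ)} := by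
    rintro _ ⟨v, rfl⟩
    choose m hm using hint
    refine ⟨∑ i, ∑ j, v i0 i * (m i j * v i1 j), ?_⟩
    simp only [Gam, P, zc, dotProduct, mulVec, Finset.mul_sum]
    push_cast
    refine Finset.sum_congr rfl fun i _ => Finset.sum_congr rfl fun j _ => ?_
    rw [← hm]; ring
  obtain ⟨m, hm⟩ := hclosed.closure_subset_iff.2 hsub hcl
  have hne : i1 ≠ i0 := by simp [i0, i1, Fin.ext_iff]
  have hval : c * Gam A (fun i => if i = i0 then x else e) P = 1 / 2 := by
    simp only [Gam, P, if_true, if_neg hne, x, smul_dotProduct, smul_eq_mul]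
    field_simp
  rw [hval] at hm
  have h2 : (2 * m : ℝ) = 1 := by linarith
  have h3 : 2 * m = 1 := by exact_mod_cast h2
  omega

/-- Theorem 2.1: for `n ≥ 2` and `2 ≤ k ≤ 2n-1`, the integer image set of
`(⟨v_i, v_j⟩^g)_{i<j}` is dense in the real image set iff the form is irrational. -/
theorem stmt1 (n k : ℕ) (hn : 2 ≤ n) (hk2 : 2 ≤ k) (hk : k ≤ 2*n - 1) (g : SL2n n) :
    ({t : Pairs k → ℝ | ∃ v : Fin k → (Fin (2*n) → ℝ), ∀ p : Pairs k,
        t p = sympG n g (v p.1.1) (v p.1.2)} ⊆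
      closure {t : Pairs k → ℝ | ∃ v : Fin k → (Fin (2*n) → ℤ), ∀ p : Pairs k,
        t p = sympG n g (fun j => ((v p.1.1 j : ℤ) : ℝ)) (fun j => ((v p.1.2 j : ℤ) : ℝ))})
    ↔ ¬ IsRationalForm n g := by
  have hu := AA_unit n g
  have hAB : AA n g * (AA n g)⁻¹ = 1 := mul_nonsing_inv _ hu
  have hBA : (AA n g)⁻¹ * AA n g = 1 := nonsing_inv_mul _ hu
  have hR : {t : Pairs k → ℝ | ∃ v : Fin k → (Fin (2*n) → ℝ), ∀ p : Pairs k,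
        t p = sympG n g (v p.1.1) (v p.1.2)} = Set.range (Gam (k := k) (AA n g)) := by
    ext t
    simp only [Set.mem_setOf_eq, Set.mem_range, AA_form]
    exact exists_congr fun v => ⟨fun h => (funext h).symm, fun h p => by rw [← h]; rfl⟩
  have hS : {t : Pairs k → ℝ | ∃ v : Fin k → (Fin (2*n) → ℤ), ∀ p : Pairs k,
        t p = sympG n g (fun j => ((v p.1.1 j : ℤ) : ℝ)) (fun j => ((v p.1.2 j : ℤ) : ℝ))}
      = SS k (AA n g) := by
    ext t
    simp only [Set.mem_setOf_eq, SS, AA_form]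
    exact exists_congr fun v => ⟨fun h => funext h, fun h p => by rw [h]; rfl⟩
  rw [hR, hS]
  change _ ↔ ¬ RatM (AA n g)
  constructor
  · intro hsub hrat
    obtain ⟨X, hX⟩ := not_dense (k := k) (by omega : 0 < 2 * n) hk2 (AA n g) _ hBA hrat
    exact hX (hsub ⟨X, rfl⟩)
  · rintro hA _ ⟨X, rfl⟩
    exact dense_main (by omega) (AA n g) _ (AA_alt n (by omega) g) hAB hBA hA X
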